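/- Let (p^x) be a transition family for the G-lift with H_t^i < ∞ for all i ∈ S and t ≥ 0, and assume the support graph of the G-lift (the graph on S × G whose edges are pairs {(i,g), (j, g·σ i j)} with i ≠ j and q i j > 0) is connected. If lim_{t→∞} MI^a(X_1, X_t) > 0 for some a ∈ S, then lim_{t→∞} MI^b(X_1, X_t) > 0 for every b ∈ S. (These limits exist, since for each i the function t ↦ MI^i(X_1, X_t) is non-increasing for t > 1 and nonnegative.) -/

import Mathlib

open Filter

noncomputable section

/-- Right-hand side of the master equation of the G-lift at state `x`. -/
def mEqDerivG {S : Type} [Fintype S] [DecidableEq S] {G : Type} [Group G]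
    (q : S → S → ℝ) (σ : S → S → G)
    (f : S × G → ℝ) (x : S × G) : ℝ :=
  ∑ j ∈ Finset.univ.erase x.1,
    (f (j, x.2 * σ x.1 j) * q j x.1 - f x * q x.1 j)

/-- `p` is a solution of the master equation of the G-lift. -/
def IsMasterSolutionG {S : Type} [Fintype S] [DecidableEq S] {G : Type} [Group G]
    (q : S → S → ℝ) (σ : S → S → G) (p : ℝ → S × G → ℝ) : Prop :=
  (∀ t : ℝ, 0 ≤ t → (∀ x, 0 ≤ p t x) ∧ (∑' x, p t x) = 1) ∧
  (∀ (x : S × G) (t : ℝ), 0 ≤ t →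
    HasDerivWithinAt (fun s => p s x) (mEqDerivG q σ (p t) x) (Set.Ici 0) t)

/-- A transition family for the G-lift. -/
def IsTransitionFamilyG {S : Type} [Fintype S] [DecidableEq S] {G : Type} [Group G]
    (q : S → S → ℝ) (σ : S → S → G) (P : S × G → ℝ → S × G → ℝ) : Prop :=
  (∀ x, IsMasterSolutionG q σ (P x)) ∧
  (∀ x, P x 0 x = 1 ∧ ∀ y, y ≠ x → P x 0 y = 0) ∧
  (∀ x z : S × G, ∀ s t : ℝ, 0 ≤ s → 0 ≤ t →
    P x (s + t) z = ∑' y, P x s y * P y t z)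

/-- Entropy of a distribution on a countable set. -/
def Hent {X : Type*} (r : X → ℝ) : ℝ := ∑' x, Real.negMulLog (r x)

/-- Mutual information of a joint distribution on a product of countable sets. -/
def MI {Y Z : Type*} (ρ : Y × Z → ℝ) : ℝ :=
  ∑' yz : Y × Z,
    ρ yz * Real.log (ρ yz / ((∑' z, ρ (yz.1, z)) * ∑' y, ρ (y, yz.2)))

/-- A strictly positive probability vector. -/
structure IsPosProb {X : Type*} (r : X → ℝ) : Prop where
  pos : ∀ x, 0 < r x
  hasSum : HasSum r 1

/-- The summand of the Kullback–Leibler divergence, normalised to be nonnegative. -/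
def klTerm (r s : ℝ) : ℝ := r * Real.log (r / s) - r + s

/-- Kullback–Leibler divergence of probability vectors. -/
def klSum {X : Type*} (r s : X → ℝ) : ℝ := ∑' x, klTerm (r x) (s x)

/-- The mixture of the vectors `K y` with weights `μ y`. -/
def mix {Y Z : Type*} (μ : Y → ℝ) (K : Y → Z → ℝ) (z : Z) : ℝ := ∑' y, μ y * K y z

lemma tangent_le_klTerm {r s c : ℝ} (hr : 0 < r) (hs : 0 < s) (hc : 0 < c) :
    r * Real.log c - c * s + s ≤ klTerm r s := by
  have h := Real.log_le_sub_one_of_pos (x := c * s / r) (by positivity)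
  rw [Real.log_div (by positivity) hr.ne', Real.log_mul hc.ne' hs.ne'] at h
  have h2 := mul_le_mul_of_nonneg_left h hr.le
  have h3 : r * (c * s / r - 1) = c * s - r := by field_simp
  rw [h3] at h2
  rw [klTerm, Real.log_div hr.ne' hs.ne']
  linarith

lemma klTerm_nonneg {r s : ℝ} (hr : 0 < r) (hs : 0 < s) : 0 ≤ klTerm r s := by
  have := tangent_le_klTerm hr hs one_pos
  simpa using this

lemma klTerm_le_neg_log {r s m : ℝ} (hr : 0 < r) (hs : 0 < s) (hm : 0 < m) (h : m * r ≤ s) :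
    klTerm r s ≤ r * (-Real.log m) - r + s := by
  have h1 : Real.log (r / s) ≤ -Real.log m := by
    rw [← Real.log_inv]
    apply Real.log_le_log (by positivity)
    rw [div_le_iff₀ hs, inv_mul_eq_div, le_div_iff₀ hm]
    linarith
  have := mul_le_mul_of_nonneg_left h1 hr.le
  rw [klTerm]
  linarith

lemma klTerm_le_abs_sub_div {r s m : ℝ} (hr : 0 < r) (hs : 0 < s) (hm : 0 < m) (hm1 : m ≤ 1)
    (h : m * r ≤ s) : klTerm r s ≤ |r - s| / m := by
  have h1 : klTerm r s ≤ (r - s) * (r - s) / s := by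
    have h := mul_le_mul_of_nonneg_left
      (Real.log_le_sub_one_of_pos (x := r / s) (by positivity)) hr.le
    have h2 : (r - s) * (r - s) / s = r * (r / s - 1) - r + s := by field_simp; ring
    rw [klTerm, h2]
    linarith
  refine h1.trans ?_
  rw [div_le_div_iff₀ hs hm, ← abs_mul_abs_self (r - s), mul_assoc]
  refine mul_le_mul_of_nonneg_left ?_ (abs_nonneg _)
  rw [← abs_of_pos hm, ← abs_mul, abs_le]
  constructor <;> nlinarith

lemma abs_sub_le_klTerm {r s ε : ℝ} (hr : 0 < r) (hs : 0 < s) (hε : 0 < ε) :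
    |r - s| ≤ klTerm r s / (2 * ε) + ε * (r + s) := by
  obtain ⟨u, hu, rfl⟩ : ∃ u, 0 < u ∧ u ^ 2 = r := ⟨√r, by positivity, Real.sq_sqrt hr.le⟩
  obtain ⟨v, hv, rfl⟩ : ∃ v, 0 < v ∧ v ^ 2 = s := ⟨√s, by positivity, Real.sq_sqrt hs.le⟩
  have hk : (u - v) ^ 2 ≤ klTerm (u ^ 2) (v ^ 2) := by
    have h := Real.log_le_sub_one_of_pos (x := v / u) (by positivity)
    have h2 := mul_le_mul_of_nonneg_left h (by positivity : 0 ≤ 2 * u ^ 2)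
    have h3 : 2 * u ^ 2 * (v / u - 1) = 2 * (u * v) - 2 * u ^ 2 := by field_simp
    rw [h3, Real.log_div hv.ne' hu.ne'] at h2
    rw [klTerm, ← div_pow, Real.log_pow, Real.log_div hu.ne' hv.ne']
    push_cast
    nlinarith
  have h1 : |u ^ 2 - v ^ 2| ≤ (u - v) ^ 2 / (2 * ε) + ε * (u ^ 2 + v ^ 2) := by
    have h2 : (u - v) ^ 2 / (2 * ε) + ε * (u ^ 2 + v ^ 2)
        = ((u - v) ^ 2 + 2 * ε ^ 2 * (u ^ 2 + v ^ 2)) / (2 * ε) := by field_simp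
    rw [h2, le_div_iff₀ (by positivity), ← abs_of_pos (by positivity : 0 < 2 * ε), ← abs_mul,
      abs_le]
    constructor <;>
      nlinarith [sq_nonneg (u - v + ε * (u + v)), sq_nonneg (u - v - ε * (u + v)),
        sq_nonneg (ε * (u - v))]
  have := div_le_div_of_nonneg_right hk (by positivity : 0 ≤ 2 * ε)
  linarith

namespace IsPosProb

variable {X Y Z : Type*}

lemma le_one {r : X → ℝ} (hr : IsPosProb r) (x : X) : r x ≤ 1 :=
  le_hasSum hr.hasSum x fun y _ => (hr.pos y).le

lemma summable {r : X → ℝ} (hr : IsPosProb r) : Summable r := hr.hasSum.summable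

lemma hasSum_prod {μ : Y → ℝ} {K : Y → Z → ℝ} (hμ : IsPosProb μ) (hK : ∀ y, IsPosProb (K y)) :
    HasSum (fun x : Y × Z => μ x.1 * K x.1 x.2) 1 := by
  have h (y : Y) : HasSum (fun z => μ y * K y z) (μ y) := by
    simpa using (hK y).hasSum.mul_left (μ y)
  have hs : Summable (fun x : Y × Z => μ x.1 * K x.1 x.2) := by
    rw [summable_prod_of_nonneg fun x => (mul_pos (hμ.pos _) ((hK _).pos _)).le]
    refine ⟨fun y => (h y).summable, ?_⟩
    simpa only [(h _).tsum_eq] using hμ.summable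
  have := hs.hasSum.prod_fiberwise h
  rw [← this.unique hμ.hasSum]
  exact hs.hasSum

lemma hasSum_mix {μ : Y → ℝ} {K : Y → Z → ℝ} (hμ : IsPosProb μ) (hK : ∀ y, IsPosProb (K y))
    (z : Z) : HasSum (fun y => μ y * K y z) (mix μ K z) :=
  (Summable.of_nonneg_of_le (fun y => (mul_pos (hμ.pos y) ((hK y).pos z)).le)
    (fun y => mul_le_of_le_one_right (hμ.pos y).le ((hK y).le_one z)) hμ.summable).hasSum

lemma mul_le_mix {μ : Y → ℝ} {K : Y → Z → ℝ} (hμ : IsPosProb μ) (hK : ∀ y, IsPosProb (K y))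
    (y : Y) (z : Z) : μ y * K y z ≤ mix μ K z :=
  le_hasSum (hμ.hasSum_mix hK z) y fun y' _ => (mul_pos (hμ.pos y') ((hK y').pos z)).le

lemma isPosProb_mix {μ : Y → ℝ} {K : Y → Z → ℝ} (hμ : IsPosProb μ) (hK : ∀ y, IsPosProb (K y)) :
    IsPosProb (mix μ K) where
  pos z := by
    obtain ⟨y⟩ : Nonempty Y := by
      by_contra h
      rw [not_nonempty_iff] at h
      exact zero_ne_one (hasSum_empty.unique hμ.hasSum)
    exact (mul_pos (hμ.pos y) ((hK y).pos z)).trans_le (hμ.mul_le_mix hK y z)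
  hasSum := ((Equiv.prodComm Z Y).hasSum_iff.mpr (hμ.hasSum_prod hK)).prod_fiberwise
    fun z => hμ.hasSum_mix hK z

lemma mix_mix {r : X → ℝ} {K : X → Y → ℝ} {L : Y → Z → ℝ} (hr : IsPosProb r)
    (hK : ∀ x, IsPosProb (K x)) (hL : ∀ y, IsPosProb (L y)) :
    mix (mix r K) L = mix r (fun x => mix (K x) L) := by
  ext z
  have hs : Summable (fun x : X × Y => r x.1 * K x.1 x.2 * L x.2 z) :=
    Summable.of_nonneg_of_le
      (fun x => (mul_pos (mul_pos (hr.pos _) ((hK _).pos _)) ((hL _).pos _)).le)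
      (fun x => mul_le_of_le_one_right (mul_pos (hr.pos _) ((hK _).pos _)).le ((hL _).le_one _))
      (hr.hasSum_prod hK).summable
  have h := Summable.tsum_comm (f := fun x y => r x * K x y * L y z) hs
  simp only [mix, ← tsum_mul_left, ← tsum_mul_right]
  simpa only [mul_assoc] using h

lemma summable_klTerm {r s : X → ℝ} (hr : IsPosProb r) (hs : IsPosProb s) {m : ℝ} (hm : 0 < m)
    (h : ∀ x, m * r x ≤ s x) : Summable (fun x => klTerm (r x) (s x)) :=
  Summable.of_nonneg_of_le (fun x => klTerm_nonneg (hr.pos x) (hs.pos x))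
    (fun x => klTerm_le_neg_log (hr.pos x) (hs.pos x) hm (h x))
    (((hr.summable.mul_right _).sub hr.summable).add hs.summable)

lemma klSum_le_neg_log {r s : X → ℝ} (hr : IsPosProb r) (hs : IsPosProb s) {m : ℝ} (hm : 0 < m)
    (h : ∀ x, m * r x ≤ s x) : klSum r s ≤ -Real.log m := by
  have h1 := hasSum_le (fun x => klTerm_le_neg_log (hr.pos x) (hs.pos x) hm (h x))
    (hr.summable_klTerm hs hm h).hasSum
    (((hr.hasSum.mul_right (-Real.log m)).sub hr.hasSum).add hs.hasSum)
  simpa [klSum] using h1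

lemma klSum_nonneg {r s : X → ℝ} (hr : IsPosProb r) (hs : IsPosProb s) : 0 ≤ klSum r s :=
  tsum_nonneg fun x => klTerm_nonneg (hr.pos x) (hs.pos x)

lemma summable_abs_sub {r s : X → ℝ} (hr : IsPosProb r) (hs : IsPosProb s) :
    Summable (fun x => |r x - s x|) :=
  (hr.summable.sub hs.summable).abs

lemma klSum_le_tsum_abs_sub {r s : X → ℝ} (hr : IsPosProb r) (hs : IsPosProb s) {m : ℝ}
    (hm : 0 < m) (hm1 : m ≤ 1) (h : ∀ x, m * r x ≤ s x) :
    klSum r s ≤ (∑' x, |r x - s x|) / m :=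
  hasSum_le (fun x => klTerm_le_abs_sub_div (hr.pos x) (hs.pos x) hm hm1 (h x))
    (hr.summable_klTerm hs hm h).hasSum ((hr.summable_abs_sub hs).hasSum.div_const m)

lemma tsum_abs_sub_le_klSum {r s : X → ℝ} (hr : IsPosProb r) (hs : IsPosProb s)
    (hsum : Summable (fun x => klTerm (r x) (s x))) {ε : ℝ} (hε : 0 < ε) :
    ∑' x, |r x - s x| ≤ klSum r s / (2 * ε) + 2 * ε := by
  have := hasSum_le (fun x => abs_sub_le_klTerm (hr.pos x) (hs.pos x) hε)
    (hr.summable_abs_sub hs).hasSum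
    ((hsum.hasSum.div_const (2 * ε)).add ((hr.hasSum.add hs.hasSum).mul_left ε))
  rw [klSum]
  linarith

/-- The data processing inequality. -/
lemma klSum_mix_le {r s : Y → ℝ} {L : Y → Z → ℝ} (hr : IsPosProb r) (hs : IsPosProb s)
    (hL : ∀ y, IsPosProb (L y)) (hsum : Summable (fun y => klTerm (r y) (s y))) :
    klSum (mix r L) (mix s L) ≤ klSum r s := by
  have hnn (x : Y × Z) : 0 ≤ klTerm (r x.1) (s x.1) * L x.1 x.2 :=
    mul_nonneg (klTerm_nonneg (hr.pos _) (hs.pos _)) ((hL _).pos _).le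
  have hy (y : Y) : HasSum (fun z => klTerm (r y) (s y) * L y z) (klTerm (r y) (s y)) := by
    simpa using (hL y).hasSum.mul_left (klTerm (r y) (s y))
  have hprod : Summable (fun x : Y × Z => klTerm (r x.1) (s x.1) * L x.1 x.2) := by
    rw [summable_prod_of_nonneg hnn]
    refine ⟨fun y => (hy y).summable, ?_⟩
    simpa only [(hy _).tsum_eq] using hsum
  have hswap := (Equiv.prodComm Z Y).summable_iff.mpr hprod
  have hle (z : Z) : klTerm (mix r L z) (mix s L z) ≤ ∑' y, klTerm (r y) (s y) * L y z := by
    have hr' := (hr.isPosProb_mix hL).pos z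
    have hs' := (hs.isPosProb_mix hL).pos z
    have hc : 0 < mix r L z / mix s L z := div_pos hr' hs'
    have hsz : Summable (fun y => klTerm (r y) (s y) * L y z) := hswap.prod_factor z
    have hrz := hr.hasSum_mix hL z
    have hsz' := hs.hasSum_mix hL z
    have h := hasSum_le (fun y => ?_)
      (((hrz.mul_right (Real.log (mix r L z / mix s L z))).sub
        (hsz'.mul_left (mix r L z / mix s L z))).add hsz') hsz.hasSum
    · rwa [div_mul_cancel₀ _ hs'.ne'] at h
    · have := mul_le_mul_of_nonneg_right (tangent_le_klTerm (hr.pos y) (hs.pos y) hc)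
        ((hL y).pos z).le
      linarith
  have hout : HasSum (fun z => ∑' y, klTerm (r y) (s y) * L y z) (klSum r s) := by
    have h1 : Summable (fun z => ∑' y, klTerm (r y) (s y) * L y z) := hswap.prod
    have h2 := Summable.tsum_comm (f := fun y z => klTerm (r y) (s y) * L y z) hprod
    simp only [(hy _).tsum_eq] at h2
    rw [klSum, ← h2]
    exact h1.hasSum
  have hin : Summable (fun z => klTerm (mix r L z) (mix s L z)) :=
    Summable.of_nonneg_of_le
      (fun z => klTerm_nonneg ((hr.isPosProb_mix hL).pos z) ((hs.isPosProb_mix hL).pos z))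
      hle hout.summable
  exact hasSum_le hle hin.hasSum hout

lemma klSum_kernel_mix_le {μ : Y → ℝ} {K : Y → Z → ℝ} (hμ : IsPosProb μ)
    (hK : ∀ y, IsPosProb (K y)) (y : Y) :
    μ y * klSum (K y) (mix μ K) ≤ Real.negMulLog (μ y) := by
  have := mul_le_mul_of_nonneg_left ((hK y).klSum_le_neg_log (hμ.isPosProb_mix hK) (hμ.pos y)
    fun z => hμ.mul_le_mix hK y z) (hμ.pos y).le
  rw [Real.negMulLog]
  linarith

/-- Mutual information as an average of divergences from the mixture. -/
lemma hasSum_MI {μ : Y → ℝ} {K : Y → Z → ℝ} (hμ : IsPosProb μ) (hK : ∀ y, IsPosProb (K y))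
    (hent : Summable (fun y => Real.negMulLog (μ y))) :
    HasSum (fun y => μ y * klSum (K y) (mix μ K))
      (MI (fun x : Y × Z => μ x.1 * K x.1 x.2)) := by
  have hmix := hμ.isPosProb_mix hK
  have hy (y : Y) : HasSum (fun z => μ y * klTerm (K y z) (mix μ K z))
      (μ y * klSum (K y) (mix μ K)) :=
    ((hK y).summable_klTerm hmix (hμ.pos y) fun z => hμ.mul_le_mix hK y z).hasSum.mul_left _
  have hs : Summable (fun x : Y × Z => μ x.1 * klTerm (K x.1 x.2) (mix μ K x.2)) := by
    rw [summable_prod_of_nonneg fun x =>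
      mul_nonneg (hμ.pos _).le (klTerm_nonneg ((hK _).pos _) (hmix.pos _))]
    refine ⟨fun y => (hy y).summable, ?_⟩
    simp only [(hy _).tsum_eq]
    exact Summable.of_nonneg_of_le
      (fun y => mul_nonneg (hμ.pos y).le ((hK y).klSum_nonneg hmix))
      (fun y => hμ.klSum_kernel_mix_le hK y) hent
  have hMI : MI (fun x : Y × Z => μ x.1 * K x.1 x.2)
      = ∑' x : Y × Z, μ x.1 * klTerm (K x.1 x.2) (mix μ K x.2) := by
    have h := (hs.hasSum.add (hμ.hasSum_prod hK)).sub (hμ.hasSum_prod fun _ => hmix)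
    rw [add_sub_cancel_right] at h
    rw [← h.tsum_eq, MI]
    refine tsum_congr fun x => ?_
    have h1 : ∑' z, μ x.1 * K x.1 z = μ x.1 := by
      rw [tsum_mul_left, (hK x.1).hasSum.tsum_eq, mul_one]
    have h2 : ∑' y, μ y * K y x.2 = mix μ K x.2 := rfl
    simp only [h1, h2, klTerm]
    rw [mul_div_mul_left _ _ (hμ.pos x.1).ne']
    ring
  rw [hMI]
  exact hs.hasSum.prod_fiberwise hy

lemma MI_nonneg {μ : Y → ℝ} {K : Y → Z → ℝ} (hμ : IsPosProb μ) (hK : ∀ y, IsPosProb (K y))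
    (hent : Summable (fun y => Real.negMulLog (μ y))) :
    0 ≤ MI (fun x : Y × Z => μ x.1 * K x.1 x.2) :=
  (hμ.hasSum_MI hK hent).nonneg fun y =>
    mul_nonneg (hμ.pos y).le ((hK y).klSum_nonneg (hμ.isPosProb_mix hK))

lemma MI_mix_le {W : Type*} {μ : Y → ℝ} {K : Y → Z → ℝ} {L : Z → W → ℝ} (hμ : IsPosProb μ)
    (hK : ∀ y, IsPosProb (K y)) (hL : ∀ z, IsPosProb (L z))
    (hent : Summable (fun y => Real.negMulLog (μ y))) :
    MI (fun x : Y × W => μ x.1 * mix (K x.1) L x.2)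
      ≤ MI (fun x : Y × Z => μ x.1 * K x.1 x.2) := by
  refine hasSum_le (fun y => ?_)
    (hμ.hasSum_MI (fun y => (hK y).isPosProb_mix hL) hent) (hμ.hasSum_MI hK hent)
  rw [← hμ.mix_mix hK hL]
  have hmix := hμ.isPosProb_mix hK
  exact mul_le_mul_of_nonneg_left ((hK y).klSum_mix_le hmix hL
    ((hK y).summable_klTerm hmix (hμ.pos y) fun z => hμ.mul_le_mix hK y z)) (hμ.pos y).le

/-- Vanishing mutual information forces the rows of the kernel to merge in `ℓ¹`. -/
lemma tendsto_abs_sub_of_MI {ι : Type*} {l : Filter ι} {μ : Y → ℝ} {K : ι → Y → Z → ℝ}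
    (hμ : IsPosProb μ) (hK : ∀ᶠ t in l, ∀ y, IsPosProb (K t y))
    (hent : Summable (fun y => Real.negMulLog (μ y)))
    (hMI : Tendsto (fun t => MI (fun x : Y × Z => μ x.1 * K t x.1 x.2)) l (nhds 0)) (y y' : Y) :
    Tendsto (fun t => ∑' z, |K t y z - K t y' z|) l (nhds 0) := by
  have key (y : Y) : Tendsto (fun t => ∑' z, |K t y z - mix μ (K t) z|) l (nhds 0) := by
    rw [Metric.tendsto_nhds]
    intro ε hε
    have hm := hμ.pos y
    have hev := hMI.eventually_lt_const (show 0 < μ y * (ε ^ 2 / 8) by positivity)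
    filter_upwards [hK, hev] with t hKt ht
    have hmix := hμ.isPosProb_mix hKt
    have h1 : μ y * klSum (K t y) (mix μ (K t)) ≤ _ :=
      le_hasSum (hμ.hasSum_MI hKt hent) y fun y' _ =>
        mul_nonneg (hμ.pos y').le ((hKt y').klSum_nonneg hmix)
    have h2 := lt_of_mul_lt_mul_left (h1.trans_lt ht) hm.le
    have h3 := (hKt y).tsum_abs_sub_le_klSum hmix
      ((hKt y).summable_klTerm hmix hm fun z => hμ.mul_le_mix hKt y z)
      (show 0 < ε / 4 by positivity)
    have h4 : klSum (K t y) (mix μ (K t)) / (2 * (ε / 4)) < ε / 2 := by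
      rw [div_lt_iff₀ (by positivity)]
      nlinarith
    rw [Real.dist_eq, sub_zero, abs_of_nonneg (tsum_nonneg fun z => abs_nonneg _)]
    linarith
  refine squeeze_zero' (Eventually.of_forall fun t => tsum_nonneg fun z => abs_nonneg _) ?_
    (by simpa using (key y).add (key y'))
  filter_upwards [hK] with t hKt
  have hmix := hμ.isPosProb_mix hKt
  refine hasSum_le (fun z => ?_) ((hKt y).summable_abs_sub (hKt y')).hasSum
    (((hKt y).summable_abs_sub hmix).hasSum.add ((hKt y').summable_abs_sub hmix).hasSum)
  rw [abs_sub_comm (K t y' z)]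
  exact abs_sub_le _ _ _

lemma tsum_abs_sub_le_two {r s : X → ℝ} (hr : IsPosProb r) (hs : IsPosProb s) :
    ∑' x, |r x - s x| ≤ 2 := by
  have := hasSum_le (fun x => abs_sub (r x) (s x)) (hr.summable_abs_sub hs).hasSum
    (hr.summable.abs.hasSum.add hs.summable.abs.hasSum)
  simp only [abs_of_pos (hr.pos _), abs_of_pos (hs.pos _), hr.hasSum.tsum_eq,
    hs.hasSum.tsum_eq] at this
  linarith

lemma tsum_abs_sub_mix_le {μ : Y → ℝ} {K : Y → Z → ℝ} {r : Z → ℝ} (hμ : IsPosProb μ)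
    (hK : ∀ y, IsPosProb (K y)) (hr : IsPosProb r) :
    ∑' z, |r z - mix μ K z| ≤ ∑' y, μ y * ∑' z, |r z - K y z| := by
  have hy (y : Y) : HasSum (fun z => μ y * |r z - K y z|) (μ y * ∑' z, |r z - K y z|) :=
    (hr.summable_abs_sub (hK y)).hasSum.mul_left _
  have hs : Summable (fun x : Y × Z => μ x.1 * |r x.2 - K x.1 x.2|) := by
    rw [summable_prod_of_nonneg fun x => mul_nonneg (hμ.pos _).le (abs_nonneg _)]
    refine ⟨fun y => (hy y).summable, ?_⟩
    simp only [(hy _).tsum_eq]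
    exact Summable.of_nonneg_of_le
      (fun y => mul_nonneg (hμ.pos y).le (tsum_nonneg fun z => abs_nonneg _))
      (fun y => mul_le_mul_of_nonneg_left (hr.tsum_abs_sub_le_two (hK y)) (hμ.pos y).le)
      (hμ.summable.mul_right 2)
  have hswap := (Equiv.prodComm Z Y).summable_iff.mpr hs
  have h2 := Summable.tsum_comm (f := fun y z => μ y * |r z - K y z|) hs
  simp only [(hy _).tsum_eq] at h2
  rw [← h2]
  have hout : Summable (fun z => ∑' y, μ y * |r z - K y z|) := hswap.prod
  refine hasSum_le (fun z => ?_) (hr.summable_abs_sub (hμ.isPosProb_mix hK)).hasSum hout.hasSum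
  have hz : Summable (fun y => μ y * |r z - K y z|) := hswap.prod_factor z
  have h3 := (hμ.hasSum.mul_right (r z)).sub (hμ.hasSum_mix hK z)
  rw [one_mul] at h3
  have h4 (y : Y) : ‖μ y * r z - μ y * K y z‖ ≤ μ y * |r z - K y z| := by
    rw [← mul_sub, norm_mul, Real.norm_of_nonneg (hμ.pos y).le, Real.norm_eq_abs]
  rw [← h3.tsum_eq, ← Real.norm_eq_abs]
  exact tsum_of_norm_bounded hz.hasSum h4

/-- If the rows of the kernel merge in `ℓ¹` and the input has finite entropy, then the mutual
information vanishes. -/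
lemma tendsto_MI_of_abs_sub {ι : Type*} {l : Filter ι} {μ : Y → ℝ} {K : ι → Y → Z → ℝ}
    (hμ : IsPosProb μ) (hK : ∀ᶠ t in l, ∀ y, IsPosProb (K t y))
    (hent : Summable (fun y => Real.negMulLog (μ y)))
    (h : ∀ y y', Tendsto (fun t => ∑' z, |K t y z - K t y' z|) l (nhds 0)) :
    Tendsto (fun t => MI (fun x : Y × Z => μ x.1 * K t x.1 x.2)) l (nhds 0) := by
  have hmerge (y : Y) : Tendsto (fun t => ∑' z, |K t y z - mix μ (K t) z|) l (nhds 0) := by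
    have hlim : Tendsto (fun t => ∑' y', μ y' * ∑' z, |K t y z - K t y' z|) l
        (nhds (∑' _ : Y, (0 : ℝ))) := by
      refine tendsto_tsum_of_dominated_convergence (hμ.summable.mul_right 2)
        (fun y' => by simpa using (h y y').const_mul (μ y')) ?_
      filter_upwards [hK] with t hKt y'
      rw [Real.norm_of_nonneg (mul_nonneg (hμ.pos y').le (tsum_nonneg fun z => abs_nonneg _))]
      exact mul_le_mul_of_nonneg_left ((hKt y).tsum_abs_sub_le_two (hKt y')) (hμ.pos y').le
    rw [tsum_zero] at hlim
    refine squeeze_zero' (Eventually.of_forall fun t => tsum_nonneg fun z => abs_nonneg _) ?_ hlim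
    filter_upwards [hK] with t hKt
    exact hμ.tsum_abs_sub_mix_le hKt (hKt y)
  have hlim : Tendsto (fun t => ∑' y, μ y * klSum (K t y) (mix μ (K t))) l
      (nhds (∑' _ : Y, (0 : ℝ))) := by
    refine tendsto_tsum_of_dominated_convergence hent (fun y => ?_) ?_
    · refine squeeze_zero' ?_ ?_ (hmerge y)
      · filter_upwards [hK] with t hKt
        exact mul_nonneg (hμ.pos y).le ((hKt y).klSum_nonneg (hμ.isPosProb_mix hKt))
      · filter_upwards [hK] with t hKt
        have := (hKt y).klSum_le_tsum_abs_sub (hμ.isPosProb_mix hKt) (hμ.pos y) (hμ.le_one y)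
          fun z => hμ.mul_le_mix hKt y z
        rw [le_div_iff₀ (hμ.pos y)] at this
        linarith
    · filter_upwards [hK] with t hKt y
      rw [Real.norm_of_nonneg
        (mul_nonneg (hμ.pos y).le ((hKt y).klSum_nonneg (hμ.isPosProb_mix hKt)))]
      exact hμ.klSum_kernel_mix_le hKt y
  rw [tsum_zero] at hlim
  refine hlim.congr' ?_
  filter_upwards [hK] with t hKt
  exact (hμ.hasSum_MI hKt hent).tsum_eq

end IsPosProb

/-- Suppose `f' ≥ g - c f` with `g ≥ 0` and `f 0 ≥ 0`. If `f 0 > 0`, or if `g` is positive on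
`(0, ∞)`, then `f` is positive on `(0, ∞)`. -/
lemma pos_of_deriv_ge {f f' g : ℝ → ℝ} {c : ℝ}
    (hf : ∀ t, 0 ≤ t → HasDerivWithinAt f (f' t) (Set.Ici 0) t)
    (hge : ∀ t, 0 ≤ t → g t - c * f t ≤ f' t) (hg : ∀ t, 0 ≤ t → 0 ≤ g t) (hf0 : 0 ≤ f 0)
    (h : 0 < f 0 ∨ ∀ t, 0 < t → 0 < g t) {t : ℝ} (ht : 0 < t) : 0 < f t := by
  set F : ℝ → ℝ := fun s => Real.exp (c * s) * f s
  have hE (s : ℝ) : HasDerivAt (fun s => Real.exp (c * s)) (Real.exp (c * s) * c) s := by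
    simpa using ((hasDerivAt_id s).const_mul c).exp
  have hF (s : ℝ) (hs : 0 ≤ s) : HasDerivWithinAt F
      (Real.exp (c * s) * c * f s + Real.exp (c * s) * f' s) (Set.Ici 0) s :=
    (hE s).hasDerivWithinAt.mul (hf s hs)
  have hcont : ContinuousOn F (Set.Ici 0) := fun s hs => (hF s hs).continuousWithinAt
  have hder (s : ℝ) (hs : 0 < s) :
      deriv F s = Real.exp (c * s) * c * f s + Real.exp (c * s) * f' s :=
    ((hF s hs.le).hasDerivAt (Ici_mem_nhds hs)).deriv
  have hlow (s : ℝ) (hs : 0 < s) : Real.exp (c * s) * g s ≤ deriv F s := by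
    rw [hder s hs]
    have := mul_le_mul_of_nonneg_left (hge s hs.le) (Real.exp_pos (c * s)).le
    linarith
  have hF0 : F 0 = f 0 := by simp [F]
  have hFt : 0 < F t := by
    rcases h with h | h
    · have hmono : MonotoneOn F (Set.Ici 0) := by
        refine monotoneOn_of_deriv_nonneg (convex_Ici 0) hcont ?_ ?_
        · intro s hs
          rw [interior_Ici] at hs
          exact ((hF s (le_of_lt hs)).hasDerivAt
            (Ici_mem_nhds hs)).differentiableAt.differentiableWithinAt
        · intro s hs
          rw [interior_Ici] at hs
          exact (mul_nonneg (Real.exp_pos _).le (hg s (le_of_lt hs))).trans (hlow s hs)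
      have := hmono Set.self_mem_Ici ht.le ht.le
      linarith
    · have hmono : StrictMonoOn F (Set.Ici 0) := by
        refine strictMonoOn_of_deriv_pos (convex_Ici 0) hcont ?_
        intro s hs
        rw [interior_Ici] at hs
        exact (mul_pos (Real.exp_pos _) (h s hs)).trans_le (hlow s hs)
      have := hmono Set.self_mem_Ici ht.le ht
      linarith
  exact (pos_iff_pos_of_mul_pos hFt).mp (Real.exp_pos _)

section Lift

variable {S : Type} [Fintype S] [DecidableEq S] {G : Type} [Group G]
  {q : S → S → ℝ} {σ : S → S → G}

lemma le_mEqDerivG (hq_nonneg : ∀ i j : S, i ≠ j → 0 ≤ q i j) {f : S × G → ℝ}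
    (hf : ∀ x, 0 ≤ f x) (x : S × G) {j : S} (hj : j ≠ x.1) :
    f (j, x.2 * σ x.1 j) * q j x.1 - (∑ j ∈ Finset.univ.erase x.1, q x.1 j) * f x
      ≤ mEqDerivG q σ f x := by
  rw [mEqDerivG, Finset.sum_sub_distrib, ← Finset.mul_sum, mul_comm (f x)]
  refine sub_le_sub_right ?_ _
  exact Finset.single_le_sum (f := fun j => f (j, x.2 * σ x.1 j) * q j x.1)
    (fun i hi => mul_nonneg (hf _) (hq_nonneg i x.1 (Finset.ne_of_mem_erase hi)))
    (Finset.mem_erase.mpr ⟨hj, Finset.mem_univ j⟩)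

lemma IsTransitionFamilyG.pos [Nontrivial S] (hq_nonneg : ∀ i j : S, i ≠ j → 0 ≤ q i j)
    (hσ : ∀ i j, σ j i = (σ i j)⁻¹)
    {P : S × G → ℝ → S × G → ℝ} (hP : IsTransitionFamilyG q σ P)
    (hGconn : ∀ x y : S × G,
      Relation.ReflTransGen
        (fun a b : S × G => a.1 ≠ b.1 ∧ 0 < q a.1 b.1 ∧ b.2 = a.2 * σ a.1 b.1) x y)
    (x y : S × G) {t : ℝ} (ht : 0 < t) : 0 < P x t y := by
  have hnn (t : ℝ) (ht : 0 ≤ t) := ((hP.1 x).1 t ht).1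
  have main (y : S × G) (j : S) (hj : j ≠ y.1)
      (h : 0 < P x 0 y ∨ ∀ t, 0 < t → 0 < P x t (j, y.2 * σ y.1 j) * q j y.1) :
      ∀ t, 0 < t → 0 < P x t y := fun t ht =>
    pos_of_deriv_ge ((hP.1 x).2 y)
      (fun t ht => le_mEqDerivG hq_nonneg (hnn t ht) y hj)
      (fun t ht => mul_nonneg (hnn t ht _) (hq_nonneg j y.1 hj)) (hnn 0 le_rfl y) h ht
  have key : ∀ t, 0 < t → 0 < P x t y := by
    induction hGconn x y with
    | refl =>
      obtain ⟨j, hj⟩ := exists_ne x.1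
      exact main x j hj (Or.inl (by rw [(hP.2.1 x).1]; exact one_pos))
    | @tail b c _ hbc ih =>
      obtain ⟨hne, hq, hc⟩ := hbc
      refine main c b.1 hne (Or.inr fun t ht => mul_pos ?_ hq)
      rw [hc, hσ b.1 c.1, mul_inv_cancel_right]
      exact ih t ht
  exact key t ht

lemma IsTransitionFamilyG.isPosProb [Nontrivial S] (hq_nonneg : ∀ i j : S, i ≠ j → 0 ≤ q i j)
    (hσ : ∀ i j, σ j i = (σ i j)⁻¹)
    {P : S × G → ℝ → S × G → ℝ} (hP : IsTransitionFamilyG q σ P)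
    (hGconn : ∀ x y : S × G,
      Relation.ReflTransGen
        (fun a b : S × G => a.1 ≠ b.1 ∧ 0 < q a.1 b.1 ∧ b.2 = a.2 * σ a.1 b.1) x y)
    (x : S × G) {t : ℝ} (ht : 0 < t) : IsPosProb (P x t) where
  pos y := hP.pos hq_nonneg hσ hGconn x y ht
  hasSum := by
    have h := ((hP.1 x).1 t ht.le).2
    have hs : Summable (P x t) := by
      by_contra hs
      rw [tsum_eq_zero_of_not_summable hs] at h
      exact zero_ne_one h
    exact h ▸ hs.hasSum

end Lift

theorem stmt_12 {S : Type} [Fintype S] [DecidableEq S] (hS : 2 ≤ Fintype.card S)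
    {G : Type} [Group G] [Countable G]
    (q : S → S → ℝ)
    (hq_nonneg : ∀ i j : S, i ≠ j → 0 ≤ q i j)
    (hq_sym : ∀ i j : S, i ≠ j → (0 < q i j ↔ 0 < q j i))
    (hq_conn : ∀ i j : S, Relation.ReflTransGen (fun a b => a ≠ b ∧ 0 < q a b) i j)
    (σ : S → S → G) (hσ : ∀ i j, σ j i = (σ i j)⁻¹)
    (P : S × G → ℝ → S × G → ℝ) (hP : IsTransitionFamilyG q σ P)
    -- H_t^i < ∞ for all i and t ≥ 0:
    (hH : ∀ i : S, ∀ t : ℝ, 0 ≤ t →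
      Summable (fun z => Real.negMulLog (P (i, (1 : G)) t z)))
    -- the support graph of the G-lift is connected:
    (hGconn : ∀ x y : S × G,
      Relation.ReflTransGen
        (fun a b : S × G => a.1 ≠ b.1 ∧ 0 < q a.1 b.1 ∧ b.2 = a.2 * σ a.1 b.1) x y)
    -- lim_{t→∞} MI^a(X_1, X_t) exists and is positive for some a:
    (a : S) (Ma : ℝ)
    (hMa : Tendsto
      (fun t : ℝ =>
        MI (fun yz : (S × G) × (S × G) => P (a, (1 : G)) 1 yz.1 * P yz.1 (t - 1) yz.2))
      atTop (nhds Ma))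
    (hMapos : 0 < Ma) :
    -- then lim_{t→∞} MI^b(X_1, X_t) exists and is positive for every b:
    ∀ b : S, ∃ Mb : ℝ,
      Tendsto
        (fun t : ℝ =>
          MI (fun yz : (S × G) × (S × G) => P (b, (1 : G)) 1 yz.1 * P yz.1 (t - 1) yz.2))
        atTop (nhds Mb) ∧ 0 < Mb := by
  have : Nontrivial S := Fintype.one_lt_card_iff_nontrivial.mp hS
  have hprob (x : S × G) {t : ℝ} (ht : 0 < t) : IsPosProb (P x t) :=
    hP.isPosProb hq_nonneg hσ hGconn x ht
  have hμ (i : S) : IsPosProb (P (i, (1 : G)) 1) := hprob _ one_pos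
  have hent (i : S) := hH i 1 zero_le_one
  have hK : ∀ᶠ t : ℝ in atTop, ∀ y, IsPosProb (P y (t - 1)) := by
    filter_upwards [eventually_gt_atTop 1] with t ht y
    exact hprob y (sub_pos.mpr ht)
  intro b
  obtain ⟨Mb, hMb⟩ : ∃ Mb : ℝ, Tendsto
      (fun t : ℝ =>
        MI (fun yz : (S × G) × (S × G) => P (b, (1 : G)) 1 yz.1 * P yz.1 (t - 1) yz.2))
      atTop (nhds Mb) := by
    set m : ℝ → ℝ := fun t =>
      MI (fun yz : (S × G) × (S × G) => P (b, (1 : G)) 1 yz.1 * P yz.1 (t - 1) yz.2)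
    have hanti : AntitoneOn m (Set.Ici 2) := by
      intro s hs t _ hst
      rcases hst.eq_or_lt with rfl | hst
      · exact le_rfl
      rw [Set.mem_Ici] at hs
      have h := (hμ b).MI_mix_le (fun y => hprob y (by linarith : 0 < s - 1))
        (fun z => hprob z (sub_pos.mpr hst)) (hent b)
      have hCK (y z : S × G) :
          mix (P y (s - 1)) (fun w => P w (t - s)) z = P y (t - 1) z := by
        rw [mix, ← hP.2.2 y z (s - 1) (t - s) (by linarith) (by linarith)]
        congr 1
        ring
      simpa only [hCK] using h
    have hanti' : Antitone fun t => m (max t 2) := fun s t hst =>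
      hanti (Set.mem_Ici.mpr (le_max_right _ _)) (Set.mem_Ici.mpr (le_max_right _ _))
        (max_le_max_right _ hst)
    have hbdd : BddBelow (Set.range fun t => m (max t 2)) := by
      refine ⟨0, ?_⟩
      rintro _ ⟨t, rfl⟩
      have h2 : (2 : ℝ) ≤ max t 2 := le_max_right _ _
      exact (hμ b).MI_nonneg (fun y => hprob y (by linarith)) (hent b)
    refine ⟨_, (tendsto_atTop_ciInf hanti' hbdd).congr' ?_⟩
    filter_upwards [eventually_ge_atTop 2] with t ht
    rw [max_eq_left ht]
  refine ⟨Mb, hMb, lt_of_le_of_ne (ge_of_tendsto hMb ?_) ?_⟩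
  · filter_upwards [hK] with t ht
    exact (hμ b).MI_nonneg ht (hent b)
  · rintro rfl
    have hmerge := (hμ b).tendsto_abs_sub_of_MI hK (hent b) hMb
    have h0 := (hμ a).tendsto_MI_of_abs_sub hK (hent a) hmerge
    exact hMapos.ne' (tendsto_nhds_unique hMa h0)

end
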